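/- Let K ⊆ ℝⁿ be a proper cone and let A ∈ ℝ^{n×n} be Hurwitz stable, cross-positive over K, and K-irreducible. Then for every s₀ ≥ 0 the matrix s₀I − A is invertible and (s₀I − A)^{-1} is K-positive, i.e., (s₀I − A)^{-1}(K ∖ {0}) ⊆ int K. Consequently ⟨c, (s₀I − A)^{-1}b⟩ > 0 for every nonzero b ∈ K, every nonzero c ∈ K*, and every s₀ ≥ 0. -/

import Mathlib

open Matrix

/-- A proper cone in `ℝⁿ`: a closed convex cone that is pointed and solid. -/
def IsProperCone {n : ℕ} (K : Set (Fin n → ℝ)) : Prop :=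
  IsClosed K ∧
  (∀ x ∈ K, ∀ y ∈ K, x + y ∈ K) ∧
  (∀ a : ℝ, 0 ≤ a → ∀ x ∈ K, a • x ∈ K) ∧
  (∀ x, x ∈ K → -x ∈ K → x = 0) ∧
  (interior K).Nonempty

/-- The dual cone with respect to the standard inner product on `ℝⁿ`. -/
def dualCone {n : ℕ} (K : Set (Fin n → ℝ)) : Set (Fin n → ℝ) :=
  {y | ∀ x ∈ K, 0 ≤ y ⬝ᵥ x}

/-- `A` is cross-positive over `K`. -/
def CrossPositive {n : ℕ} (K : Set (Fin n → ℝ)) (A : Matrix (Fin n) (Fin n) ℝ) : Prop :=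
  ∀ x ∈ K, ∀ y ∈ dualCone K, y ⬝ᵥ x = 0 → 0 ≤ y ⬝ᵥ A.mulVec x

/-- `μ` is an eigenvalue of the complex matrix `M`. -/
def HasEigen {n : ℕ} (M : Matrix (Fin n) (Fin n) ℂ) (μ : ℂ) : Prop :=
  ∃ v : Fin n → ℂ, v ≠ 0 ∧ M.mulVec v = μ • v

/-- `A` is Hurwitz stable: every complex eigenvalue has negative real part. -/
def Hurwitz {n : ℕ} (A : Matrix (Fin n) (Fin n) ℝ) : Prop :=
  ∀ μ : ℂ, HasEigen (A.map Complex.ofReal) μ → μ.re < 0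

theorem aux_zero {n : ℕ} {K : Set (Fin n → ℝ)} (hK : IsProperCone K) : (0 : Fin n → ℝ) ∈ K := by
  obtain ⟨hcl, hadd, hsm, hpt, e, he⟩ := hK
  simpa using hsm 0 le_rfl e (interior_subset he)

theorem aux_convex {n : ℕ} {K : Set (Fin n → ℝ)} (hK : IsProperCone K) : Convex ℝ K := by
  obtain ⟨hcl, hadd, hsm, hpt, e, he⟩ := hK
  intro x hx y hy a b ha hb _
  exact hadd _ (hsm a ha x hx) _ (hsm b hb y hy)

theorem aux_repr {n : ℕ} (f : (Fin n → ℝ) →L[ℝ] ℝ) :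
    ∃ y : Fin n → ℝ, ∀ x, f x = y ⬝ᵥ x := by
  refine ⟨fun i => f (Pi.single i 1), fun x => ?_⟩
  have := LinearMap.pi_apply_eq_sum_univ (f : (Fin n → ℝ) →ₗ[ℝ] ℝ) x
  simp only [ContinuousLinearMap.coe_coe, smul_eq_mul] at this
  rw [this, dotProduct]
  refine Finset.sum_congr rfl fun i _ => ?_
  rw [mul_comm]
  congr 2
  ext j
  simp [Pi.single_apply, eq_comm]

theorem aux_sep {n : ℕ} {K : Set (Fin n → ℝ)} (hK : IsProperCone K) (x : Fin n → ℝ)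
    (hx : x ∉ K) : ∃ y ∈ dualCone K, y ⬝ᵥ x < 0 := by
  obtain ⟨f, u, h1, h2⟩ := geometric_hahn_banach_point_closed (aux_convex hK) hK.1 hx
  obtain ⟨y, hy⟩ := aux_repr f
  have hu := h2 0 (aux_zero hK)
  simp only [map_zero] at hu
  refine ⟨y, fun w hw => ?_, by rw [← hy]; linarith⟩
  by_contra hneg
  rw [← hy] at hneg
  push Not at hneg
  have h3 := h2 _ (hK.2.2.1 (u / f w) (div_nonneg_of_nonpos hu.le hneg.le) w hw)
  rw [map_smul, smul_eq_mul, div_mul_cancel₀ _ hneg.ne] at h3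
  exact lt_irrefl _ h3

theorem aux_pos {n : ℕ} {K : Set (Fin n → ℝ)} {b y : Fin n → ℝ} (hb : b ∈ interior K)
    (hy : y ∈ dualCone K) (hy0 : y ≠ 0) : 0 < y ⬝ᵥ b := by
  have hc : Filter.Tendsto (fun t : ℝ => b - t • y) (nhdsWithin 0 (Set.Ioi 0)) (nhds b) := by
    have : Continuous (fun t : ℝ => b - t • y) := by fun_prop
    have h := this.tendsto 0
    simp only [zero_smul, sub_zero] at h
    exact h.mono_left nhdsWithin_le_nhds
  have h1 := hc.eventually (mem_interior_iff_mem_nhds.1 hb)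
  obtain ⟨t, ht, htp⟩ := (h1.and self_mem_nhdsWithin).exists
  have h2 := hy _ ht
  rw [dotProduct_sub, dotProduct_smul, smul_eq_mul] at h2
  have h3 : 0 < y ⬝ᵥ y := by
    have h4 : 0 ≤ y ⬝ᵥ y := Finset.sum_nonneg fun i _ => mul_self_nonneg _
    exact lt_of_le_of_ne h4 fun h => hy0 (dotProduct_self_eq_zero.1 h.symm)
  have := mul_pos htp h3
  linarith

open scoped Pointwise in
theorem aux_int_add {n : ℕ} {K : Set (Fin n → ℝ)} (hK : IsProperCone K) {e w : Fin n → ℝ}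
    (he : e ∈ interior K) (hw : w ∈ K) : e + w ∈ interior K := by
  have h : interior K + {w} ⊆ interior K := by
    apply interior_maximal _ isOpen_interior.add_right
    rintro _ ⟨a, ha, b, hb, rfl⟩
    rw [Set.mem_singleton_iff] at hb
    subst hb
    exact hK.2.1 _ (interior_subset ha) _ hw
  exact h ⟨e, he, w, rfl, rfl⟩

theorem aux_int_smul {n : ℕ} {K : Set (Fin n → ℝ)} (hK : IsProperCone K) {e : Fin n → ℝ}
    (he : e ∈ interior K) {t : ℝ} (ht : 0 < t) : t • e ∈ interior K := by
  rw [mem_interior_iff_mem_nhds] at *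
  have hc : Continuous (fun v : Fin n → ℝ => t⁻¹ • v) := by fun_prop
  have h := hc.tendsto (t • e)
  rw [inv_smul_smul₀ ht.ne'] at h
  filter_upwards [h he] with v hv
  have := hK.2.2.1 t ht.le _ hv
  rwa [smul_inv_smul₀ ht.ne'] at this

theorem aux_supp {n : ℕ} {K : Set (Fin n → ℝ)} (hK : IsProperCone K) {x : Fin n → ℝ}
    (hx : x ∈ K) (hxi : x ∉ interior K) : ∃ y ∈ dualCone K, y ≠ 0 ∧ y ⬝ᵥ x = 0 := by
  obtain ⟨f, hf⟩ := geometric_hahn_banach_open_point (aux_convex hK).interior isOpen_interior hxi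
  obtain ⟨e, he⟩ := hK.2.2.2.2
  have hneg : ∀ w ∈ K, f w ≤ 0 := by
    intro w hw
    by_contra hpos
    push Not at hpos
    have ht : 0 ≤ |f x - f e| / f w := by positivity
    have := hf _ (aux_int_add hK he (hK.2.2.1 _ ht w hw))
    rw [map_add, map_smul, smul_eq_mul, div_mul_cancel₀ _ hpos.ne'] at this
    have := le_abs_self (f x - f e)
    linarith
  have hx0 : f x = 0 := by
    refine le_antisymm (hneg x hx) ?_
    by_contra h
    push Not at h
    have hfe : f e < 0 := (hf e he).trans h
    have := hf _ (aux_int_smul hK he (t := f x / (2 * f e))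
      (div_pos_of_neg_of_neg h (by linarith)))
    rw [map_smul, smul_eq_mul, div_mul_eq_mul_div, mul_comm 2, mul_comm (f x),
      mul_div_mul_left _ _ hfe.ne] at this
    linarith
  obtain ⟨y, hy⟩ := aux_repr (-f)
  refine ⟨y, fun w hw => ?_, ?_, ?_⟩
  · rw [← hy]; simpa using hneg w hw
  · rintro rfl
    have h1 := hf e he
    have h2 := hy e
    simp at h2
    linarith
  · rw [← hy]; simpa using hx0

theorem aux_phi {n : ℕ} {K : Set (Fin n → ℝ)} (hK : IsProperCone K) :
    ∃ y ∈ dualCone K, ∃ d : ℝ, 0 < d ∧ ∀ x ∈ K, d * ‖x‖ ≤ y ⬝ᵥ x := by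
  have hcomp : IsCompact (K ∩ Metric.sphere (0 : Fin n → ℝ) 1) :=
    (isCompact_sphere _ _).inter_left hK.1
  have key : ∃ y ∈ dualCone K, ∃ d : ℝ, 0 < d ∧
      ∀ x ∈ (K ∩ Metric.sphere (0 : Fin n → ℝ) 1), x ∈ K → d ≤ y ⬝ᵥ x := by
    refine hcomp.induction_on (p := fun S => ∃ y ∈ dualCone K, ∃ d : ℝ, 0 < d ∧
      ∀ x ∈ S, x ∈ K → d ≤ y ⬝ᵥ x) ?_ ?_ ?_ ?_
    · exact ⟨0, fun x _ => by simp, 1, one_pos, by simp⟩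
    · rintro s t hst ⟨y, hy, d, hd, h⟩
      exact ⟨y, hy, d, hd, fun x hx => h x (hst hx)⟩
    · rintro s t ⟨y, hy, d, hd, h⟩ ⟨y', hy', d', hd', h'⟩
      refine ⟨y + y', fun x hx => ?_, min d d', lt_min hd hd', fun x hx hxK => ?_⟩
      · rw [add_dotProduct]; exact add_nonneg (hy x hx) (hy' x hx)
      · rw [add_dotProduct]
        have h1 := hy x hxK
        have h2 := hy' x hxK
        rcases hx with hx | hx
        · have := h x hx hxK
          have := min_le_left d d'
          linarith
        · have := h' x hx hxK
          have := min_le_right d d'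
          linarith
    · rintro x ⟨hxK, hx1⟩
      have hx0 : x ≠ 0 := by rintro rfl; simp at hx1
      obtain ⟨y, hy, hyx⟩ := aux_sep hK (-x) (fun h => hx0 (hK.2.2.2.1 x hxK h))
      rw [dotProduct_neg] at hyx
      have hpos : 0 < y ⬝ᵥ x := by linarith
      refine ⟨{w | y ⬝ᵥ x / 2 < y ⬝ᵥ w}, ?_, y, hy, y ⬝ᵥ x / 2, by linarith,
        fun w hw _ => le_of_lt hw⟩
      apply mem_nhdsWithin_of_mem_nhds
      apply IsOpen.mem_nhds
      · exact isOpen_lt (by fun_prop) (by fun_prop)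
      · simp only [Set.mem_ofPred_eq]; linarith
  obtain ⟨y, hy, d, hd, h⟩ := key
  refine ⟨y, hy, d, hd, fun x hx => ?_⟩
  by_cases hx0 : x = 0
  · subst hx0; simp
  have hn : 0 < ‖x‖ := norm_pos_iff.2 hx0
  have hxs : ‖x‖⁻¹ • x ∈ K := hK.2.2.1 _ (by positivity) x hx
  have := h (‖x‖⁻¹ • x) ⟨hxs, by simp [norm_smul, hn.ne']⟩ hxs
  rw [dotProduct_smul, smul_eq_mul, ← div_eq_inv_mul, le_div_iff₀ hn] at this
  exact this

/-- Vectors dominated by multiples of `z`. -/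
def auxV {n : ℕ} (K : Set (Fin n → ℝ)) (hK : IsProperCone K) (z : Fin n → ℝ) (hz : z ∈ K) :
    Submodule ℝ (Fin n → ℝ) where
  carrier := {w | ∃ c : ℝ, 0 ≤ c ∧ c • z - w ∈ K ∧ c • z + w ∈ K}
  zero_mem' := ⟨0, le_rfl, by simpa using aux_zero hK, by simpa using aux_zero hK⟩
  add_mem' := by
    rintro a b ⟨c, hc, h1, h2⟩ ⟨c', hc', h1', h2'⟩
    refine ⟨c + c', add_nonneg hc hc', ?_, ?_⟩
    · convert hK.2.1 _ h1 _ h1' using 1; module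
    · convert hK.2.1 _ h2 _ h2' using 1; module
  smul_mem' := by
    rintro r a ⟨c, hc, h1, h2⟩
    rcases le_total 0 r with hr | hr
    · refine ⟨r * c, mul_nonneg hr hc, ?_, ?_⟩
      · convert hK.2.2.1 r hr _ h1 using 1; module
      · convert hK.2.2.1 r hr _ h2 using 1; module
    · refine ⟨(-r) * c, mul_nonneg (by linarith) hc, ?_, ?_⟩
      · convert hK.2.2.1 (-r) (by linarith) _ h2 using 1; module
      · convert hK.2.2.1 (-r) (by linarith) _ h1 using 1; module

theorem aux_KR {n : ℕ} {K : Set (Fin n → ℝ)} (hK : IsProperCone K)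
    (T : Matrix (Fin n) (Fin n) ℝ) (hT : ∀ x ∈ K, T.mulVec x ∈ K) (z : Fin n → ℝ) (hz : z ∈ K)
    (hz0 : z ≠ 0) (hTz : z - T.mulVec z ∈ K) :
    ∃ v ∈ K, v ≠ 0 ∧ (∃ c : ℝ, c • z - v ∈ K) ∧ ∃ ρ : ℝ, T.mulVec v = ρ • v := by
  obtain ⟨φ, hφ, d, hd, hφd⟩ := aux_phi hK
  have hφpos : ∀ x ∈ K, x ≠ 0 → 0 < φ ⬝ᵥ x := fun x hx hx0 =>
    lt_of_lt_of_le (mul_pos hd (norm_pos_iff.2 hx0)) (hφd x hx)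
  set V := auxV K hK z hz with hV
  have hzV : z ∈ V := by
    refine ⟨1, zero_le_one, ?_, ?_⟩
    · simpa using aux_zero hK
    · simpa using hK.2.1 _ hz _ hz
  have hTV : ∀ w ∈ V, T.mulVec w ∈ V := by
    rintro w ⟨c, hc, h1, h2⟩
    refine ⟨c, hc, ?_, ?_⟩
    · convert hK.2.1 _ (hK.2.2.1 c hc _ hTz) _ (hT _ h1) using 1
      rw [mulVec_sub, mulVec_smul]; module
    · convert hK.2.1 _ (hK.2.2.1 c hc _ hTz) _ (hT _ h2) using 1
      rw [mulVec_add, mulVec_smul]; module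
  have hTc : Continuous (fun w : Fin n → ℝ => T.mulVec w) := by fun_prop
  have hφc : Continuous (fun w : Fin n → ℝ => φ ⬝ᵥ w) := by fun_prop
  set C : Set (Fin n → ℝ) := {w | w ∈ K ∧ w ∈ V ∧ φ ⬝ᵥ w = 1} with hC
  have hCc : IsCompact C := by
    apply Metric.isCompact_of_isClosed_isBounded
    · exact hK.1.inter ((Submodule.closed_of_finiteDimensional V).inter
        (isClosed_eq hφc continuous_const))
    · refine (Metric.isBounded_closedBall (x := (0 : Fin n → ℝ)) (r := 1 / d)).subset ?_
      rintro w ⟨hw, -, h1⟩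
      have := hφd w hw
      rw [h1] at this
      rw [mem_closedBall_zero_iff, le_div_iff₀ hd]
      linarith
  have hnorm : ∀ w ∈ K, w ∈ V → w ≠ 0 → (φ ⬝ᵥ w)⁻¹ • w ∈ C := by
    intro w hw hwV hw0
    have hp := hφpos w hw hw0
    refine ⟨hK.2.2.1 _ (by positivity) _ hw, V.smul_mem _ hwV, ?_⟩
    rw [dotProduct_smul, smul_eq_mul, inv_mul_cancel₀ hp.ne']
  have hφz := hφpos z hz hz0
  have hstep : ∀ ε : ℝ, 0 < ε → ∃ w ∈ C, ∃ ρ : ℝ, T.mulVec w + ε • z = ρ • w := by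
    intro ε hε
    set S : (Fin n → ℝ) → (Fin n → ℝ) := fun w => T.mulVec w + (ε * φ ⬝ᵥ w) • z with hS
    have hSc : Continuous S := by
      simp only [hS]
      fun_prop
    have hSK : ∀ w ∈ K, S w ∈ K := fun w hw =>
      hK.2.1 _ (hT w hw) _ (hK.2.2.1 _ (mul_nonneg hε.le (hφ w hw)) _ hz)
    have hSV : ∀ w ∈ V, S w ∈ V := fun w hw => V.add_mem (hTV w hw) (V.smul_mem _ hzV)
    have hSsub : ∀ a b, S (a - b) = S a - S b := by
      intro a b
      simp only [hS, mulVec_sub, dotProduct_sub]; module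
    have hSsmul : ∀ (r : ℝ) a, S (r • a) = r • S a := by
      intro r a
      simp only [hS, mulVec_smul, dotProduct_smul, smul_eq_mul]; module
    obtain ⟨M, hM⟩ := (hCc.image (hφc.comp hSc)).bddAbove
    have hM' : ∀ w ∈ C, φ ⬝ᵥ S w ≤ M := fun w hw => hM ⟨w, hw, rfl⟩
    have hP : IsCompact ((Set.Icc (0:ℝ) M ×ˢ C) ∩ {p | S p.2 - p.1 • p.2 ∈ K}) := by
      apply (isCompact_Icc.prod hCc).inter_right
      exact hK.1.preimage ((hSc.comp continuous_snd).sub (continuous_fst.smul continuous_snd))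
    have hmem : ∀ (ρ : ℝ) w, 0 ≤ ρ → w ∈ C → S w - ρ • w ∈ K →
        (ρ, w) ∈ ((Set.Icc (0:ℝ) M ×ˢ C) ∩ {p | S p.2 - p.1 • p.2 ∈ K}) := by
      intro ρ w hρ hw h
      refine ⟨⟨⟨hρ, ?_⟩, hw⟩, h⟩
      have h1 := hφ _ h
      rw [dotProduct_sub, dotProduct_smul, hw.2.2, smul_eq_mul, mul_one] at h1
      have := hM' w hw
      change ρ ≤ M
      linarith
    have hne : ((Set.Icc (0:ℝ) M ×ˢ C) ∩ {p | S p.2 - p.1 • p.2 ∈ K}).Nonempty := by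
      refine ⟨(0, _), hmem 0 _ le_rfl (hnorm z hz hzV hz0) ?_⟩
      rw [zero_smul, sub_zero]
      exact hSK _ (hnorm z hz hzV hz0).1
    obtain ⟨⟨ρ, w⟩, ⟨⟨⟨hρ0, hρM⟩, hwC⟩, hwK⟩, hmax⟩ := hP.exists_isMaxOn hne continuous_fst.continuousOn
    simp only [Set.mem_ofPred_eq] at hwK hρ0 hρM hwC
    refine ⟨w, hwC, ρ, ?_⟩
    have hSw : S w = T.mulVec w + ε • z := by simp only [hS]; rw [hwC.2.2, mul_one]
    rw [← hSw]
    by_contra hcon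
    have hd0 : S w - ρ • w ≠ 0 := sub_ne_zero.2 hcon
    have hdp := hφpos _ hwK hd0
    have hw'K := hSK w hwC.1
    have hw'V := hSV w hwC.2.1
    have hw'0 : S w ≠ 0 := by
      intro h0
      have h1 : φ ⬝ᵥ S w = 0 := by rw [h0]; simp
      rw [hSw, dotProduct_add, dotProduct_smul, smul_eq_mul] at h1
      have h2 := hφ _ (hT w hwC.1)
      have := mul_pos hε hφz
      linarith
    obtain ⟨c, hc, hc1, -⟩ := hw'V
    set η : ℝ := ε * φ ⬝ᵥ (S w - ρ • w) / (c + 1) with hη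
    have hηp : 0 < η := by positivity
    have hmain : S (S w) - (ρ + η) • S w ∈ K := by
      have e1 : S (S w) - ρ • S w = S (S w - ρ • w) := by rw [hSsub, hSsmul]
      have e2 : S (S w) - (ρ + η) • S w = T.mulVec (S w - ρ • w) + η • (c • z - S w + z) := by
        have e3 : ε * φ ⬝ᵥ (S w - ρ • w) = η * (c + 1) := by
          rw [hη]; field_simp
        have e4 : S (S w - ρ • w) = T.mulVec (S w - ρ • w) + (η * (c + 1)) • z := by
          rw [← e3]
        rw [add_smul, ← sub_sub, e1, e4]
        module
      rw [e2]
      exact hK.2.1 _ (hT _ hwK) _ (hK.2.2.1 _ hηp.le _ (hK.2.1 _ hc1 _ hz))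
    have hfin := hmem (ρ + η) ((φ ⬝ᵥ S w)⁻¹ • S w) (by linarith)
      (hnorm _ hw'K (hSV w hwC.2.1) hw'0) (by
        have := hK.2.2.1 (φ ⬝ᵥ S w)⁻¹ (inv_nonneg.2 (hφ _ hw'K)) _ hmain
        convert this using 1
        rw [hSsmul]; module)
    have := hmax hfin
    simp only [Set.mem_ofPred_eq] at this
    linarith
  have hCne : C.Nonempty := ⟨_, hnorm z hz hzV hz0⟩
  have hgc : Continuous (fun w : Fin n → ℝ => ‖T.mulVec w - (φ ⬝ᵥ T.mulVec w) • w‖) := by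
    fun_prop
  obtain ⟨v, hvC, hmin⟩ := hCc.exists_isMinOn hCne hgc.continuousOn
  obtain ⟨B, hB⟩ := (hCc.image (f := fun w : Fin n → ℝ => ‖(φ ⬝ᵥ z) • w - z‖)
    (by fun_prop)).bddAbove
  have hle : ∀ ε : ℝ, 0 < ε → ‖T.mulVec v - (φ ⬝ᵥ T.mulVec v) • v‖ ≤ ε * B := by
    intro ε hε
    obtain ⟨w, hw, ρ, h⟩ := hstep ε hε
    have h1 : φ ⬝ᵥ T.mulVec w + ε * φ ⬝ᵥ z = ρ := by
      have := congrArg (fun x => φ ⬝ᵥ x) h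
      simpa [dotProduct_add, dotProduct_smul, hw.2.2] using this
    have h2 : T.mulVec w - (φ ⬝ᵥ T.mulVec w) • w = ε • ((φ ⬝ᵥ z) • w - z) := by
      have h3 : T.mulVec w = ρ • w - ε • z := by rw [← h]; simp
      have h4 : φ ⬝ᵥ T.mulVec w = ρ - ε * φ ⬝ᵥ z := by linarith
      rw [h4, h3]; module
    calc _ ≤ ‖T.mulVec w - (φ ⬝ᵥ T.mulVec w) • w‖ := hmin hw
      _ = ε * ‖(φ ⬝ᵥ z) • w - z‖ := by rw [h2, norm_smul, Real.norm_of_nonneg hε.le]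
      _ ≤ ε * B := mul_le_mul_of_nonneg_left (hB ⟨w, hw, rfl⟩) hε.le
  have hv0 : v ≠ 0 := by
    rintro rfl
    have := hvC.2.2
    simp at this
  obtain ⟨c, -, hc, -⟩ := hvC.2.1
  refine ⟨v, hvC.1, hv0, ⟨c, hc⟩, φ ⬝ᵥ T.mulVec v, ?_⟩
  rw [← sub_eq_zero, ← norm_le_zero_iff]
  have ht : Filter.Tendsto (fun ε : ℝ => ε * B) (nhdsWithin 0 (Set.Ioi 0)) (nhds 0) := by
    have : Continuous (fun ε : ℝ => ε * B) := by fun_prop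
    have h := this.tendsto 0
    simp only [zero_mul] at h
    exact h.mono_left nhdsWithin_le_nhds
  refine ge_of_tendsto ht ?_
  filter_upwards [self_mem_nhdsWithin] with ε hε
  exact hle ε hε

theorem aux_det {n : ℕ} (A : Matrix (Fin n) (Fin n) ℝ) (hHur : Hurwitz A) (s : ℝ) (hs : 0 ≤ s) :
    (s • (1 : Matrix (Fin n) (Fin n) ℝ) - A).det ≠ 0 := by
  intro h
  obtain ⟨v, hv0, hv⟩ := exists_mulVec_eq_zero_iff.2 h
  rw [sub_mulVec, smul_mulVec, one_mulVec, sub_eq_zero] at hv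
  have := hHur (s : ℂ) ⟨fun i => (v i : ℂ), ?_, ?_⟩
  · simp at this; linarith
  · intro h0
    apply hv0
    ext i
    have := congrFun h0 i
    simpa using this
  · ext i
    have := congrFun hv i
    simp only [mulVec, dotProduct, Pi.smul_apply, smul_eq_mul, map_apply] at this ⊢
    have h2 := congrArg (fun r : ℝ => (r : ℂ)) this
    push_cast at h2
    exact h2.symm

theorem aux_nonneg_int {n : ℕ} {K : Set (Fin n → ℝ)} (hK : IsProperCone K)
    (A : Matrix (Fin n) (Fin n) ℝ) (hHur : Hurwitz A) (hCross : CrossPositive K A)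
    (s : ℝ) (hs : 0 ≤ s) (b : Fin n → ℝ) (hb : b ∈ interior K) :
    ((s • (1 : Matrix (Fin n) (Fin n) ℝ) - A)⁻¹).mulVec b ∈ K := by
  set M : unitInterval → Matrix (Fin n) (Fin n) ℝ := fun τ =>
    ((τ : ℝ) * s + (1 - τ)) • (1 : Matrix (Fin n) (Fin n) ℝ) - (τ : ℝ) • A with hM
  have hMc : Continuous M := by simp only [hM]; fun_prop
  have hdet : ∀ τ, (M τ).det ≠ 0 := by
    intro τ
    rcases eq_or_lt_of_le τ.2.1 with h0 | h0
    · simp [hM, ← h0]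
    · have : M τ = (τ : ℝ) • ((s + (1 - τ) / τ) • (1 : Matrix (Fin n) (Fin n) ℝ) - A) := by
        simp only [hM]
        rw [smul_sub, smul_smul]
        congr 2
        field_simp
      rw [this, det_smul]
      refine mul_ne_zero (pow_ne_zero _ h0.ne') (aux_det A hHur _ ?_)
      have := τ.2.2
      have : 0 ≤ (1 - (τ : ℝ)) / τ := div_nonneg (by linarith) h0.le
      linarith
  set f : unitInterval → (Fin n → ℝ) := fun τ => ((M τ)⁻¹).mulVec b with hf
  have hfc : Continuous f := by
    have : f = fun τ => ((M τ).det⁻¹ • (M τ).adjugate).mulVec b := by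
      ext τ
      simp only [hf, inv_def, Ring.inverse_eq_inv']
    rw [this]
    exact ((hMc.matrix_det.inv₀ hdet).smul hMc.matrix_adjugate).matrix_mulVec continuous_const
  have hMf : ∀ τ, (M τ).mulVec (f τ) = b := by
    intro τ
    simp only [hf]
    rw [mulVec_mulVec, mul_nonsing_inv _ (isUnit_iff_ne_zero.2 (hdet τ)), one_mulVec]
  have heq : f ⁻¹' K = f ⁻¹' (interior K) := by
    refine Set.Subset.antisymm ?_ (Set.preimage_mono interior_subset)
    intro τ hτ
    by_contra hcon
    obtain ⟨y, hy, hy0, hyx⟩ := aux_supp hK hτ hcon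
    have h1 := aux_pos hb hy hy0
    have h2 := hCross _ hτ y hy hyx
    have h3 := hMf τ
    simp only [hM] at h3
    rw [sub_mulVec, smul_mulVec, smul_mulVec, one_mulVec] at h3
    rw [← h3, dotProduct_sub, dotProduct_smul, dotProduct_smul, hyx] at h1
    simp only [smul_eq_mul, mul_zero, zero_sub] at h1
    have := mul_nonneg τ.2.1 h2
    linarith
  have hclopen : IsClopen (f ⁻¹' K) :=
    ⟨hK.1.preimage hfc, heq ▸ isOpen_interior.preimage hfc⟩
  have hne : (f ⁻¹' K).Nonempty := by
    refine ⟨0, ?_⟩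
    have : f 0 = b := by simp [hf, hM]
    rw [Set.mem_preimage, this]
    exact interior_subset hb
  have h1 : (1 : unitInterval) ∈ f ⁻¹' K := by
    rw [hclopen.eq_univ hne]; trivial
  have h2 : f 1 = ((s • (1 : Matrix (Fin n) (Fin n) ℝ) - A)⁻¹).mulVec b := by simp [hf, hM]
  rw [← h2]
  exact h1

theorem aux_nonneg {n : ℕ} {K : Set (Fin n → ℝ)} (hK : IsProperCone K)
    (A : Matrix (Fin n) (Fin n) ℝ) (hHur : Hurwitz A) (hCross : CrossPositive K A)
    (s : ℝ) (hs : 0 ≤ s) (b : Fin n → ℝ) (hb : b ∈ K) :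
    ((s • (1 : Matrix (Fin n) (Fin n) ℝ) - A)⁻¹).mulVec b ∈ K := by
  obtain ⟨e, he⟩ := hK.2.2.2.2
  have ht : Filter.Tendsto
      (fun ε : ℝ => ((s • (1 : Matrix (Fin n) (Fin n) ℝ) - A)⁻¹).mulVec (ε • e + b))
      (nhdsWithin 0 (Set.Ioi 0))
      (nhds (((s • (1 : Matrix (Fin n) (Fin n) ℝ) - A)⁻¹).mulVec b)) := by
    have : Continuous
      (fun ε : ℝ => ((s • (1 : Matrix (Fin n) (Fin n) ℝ) - A)⁻¹).mulVec (ε • e + b)) :=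
      continuous_const.matrix_mulVec (by fun_prop)
    have h := this.tendsto 0
    simp only [zero_smul, zero_add] at h
    exact h.mono_left nhdsWithin_le_nhds
  refine hK.1.mem_of_tendsto ht ?_
  filter_upwards [self_mem_nhdsWithin] with ε hε
  exact aux_nonneg_int hK A hHur hCross s hs _ (aux_int_add hK (aux_int_smul hK he hε) hb)

theorem aux_int {n : ℕ} (K : Set (Fin n → ℝ)) (hK : IsProperCone K)
    (A : Matrix (Fin n) (Fin n) ℝ) (hHur : Hurwitz A) (hCross : CrossPositive K A)
    (hIrr : ¬ ∃ v : Fin n → ℝ, v ≠ 0 ∧ v ∈ frontier K ∧ ∃ μ : ℝ, A.mulVec v = μ • v)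
    (s₀ : ℝ) (hs₀ : 0 ≤ s₀) (x : Fin n → ℝ) (hx : x ∈ K) (hx0 : x ≠ 0) :
    ((s₀ • (1 : Matrix (Fin n) (Fin n) ℝ) - A)⁻¹).mulVec x ∈ interior K := by
  by_contra hcon
  set z := ((s₀ • (1 : Matrix (Fin n) (Fin n) ℝ) - A)⁻¹).mulVec x with hzdef
  have hz : z ∈ K := aux_nonneg hK A hHur hCross s₀ hs₀ x hx
  have hRz : (s₀ • (1 : Matrix (Fin n) (Fin n) ℝ) - A).mulVec z = x := by
    rw [hzdef, mulVec_mulVec, mul_nonsing_inv _ (isUnit_iff_ne_zero.2 (aux_det A hHur s₀ hs₀)),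
      one_mulVec]
  have hz0 : z ≠ 0 := by
    intro h
    rw [h, mulVec_zero] at hRz
    exact hx0 hRz.symm
  set N := (s₀ + 1) • (1 : Matrix (Fin n) (Fin n) ℝ) - A with hN
  have hNu : IsUnit N.det := isUnit_iff_ne_zero.2 (aux_det A hHur (s₀ + 1) (by linarith))
  have hNz : N.mulVec z = x + z := by
    rw [← hRz, hN]
    simp only [sub_mulVec, smul_mulVec, one_mulVec]
    module
  have hT : ∀ w ∈ K, (N⁻¹).mulVec w ∈ K := fun w hw =>
    aux_nonneg hK A hHur hCross (s₀ + 1) (by linarith) w hw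
  have hTz : z - (N⁻¹).mulVec z ∈ K := by
    have h1 : (N⁻¹).mulVec (N.mulVec z) = z := by
      rw [mulVec_mulVec, nonsing_inv_mul _ hNu, one_mulVec]
    rw [hNz, mulVec_add] at h1
    have h2 : z - (N⁻¹).mulVec z = (N⁻¹).mulVec x := by
      rw [sub_eq_iff_eq_add]; exact h1.symm
    rw [h2]
    exact hT x hx
  obtain ⟨v, hvK, hv0, ⟨c, hc⟩, ρ, hρ⟩ := aux_KR hK N⁻¹ hT z hz hz0 hTz
  have hNv : v = ρ • N.mulVec v := by
    rw [← mulVec_smul, ← hρ, mulVec_mulVec, mul_nonsing_inv _ hNu, one_mulVec]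
  have hρ0 : ρ ≠ 0 := by
    rintro rfl
    rw [zero_smul] at hNv
    exact hv0 hNv
  apply hIrr
  refine ⟨v, hv0, ?_, s₀ + 1 - ρ⁻¹, ?_⟩
  · rw [hK.1.frontier_eq]
    refine ⟨hvK, fun hvi => ?_⟩
    obtain ⟨y, hy, hy0, hyz⟩ := aux_supp hK hz hcon
    have h1 := aux_pos hvi hy hy0
    have h2 := hy _ hc
    rw [dotProduct_sub, dotProduct_smul, hyz, smul_zero] at h2
    linarith
  · have h1 : N.mulVec v = ρ⁻¹ • v := by
      conv_rhs => rw [hNv]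
      rw [inv_smul_smul₀ hρ0]
    rw [hN, sub_mulVec, smul_mulVec, one_mulVec] at h1
    rw [sub_smul, ← h1]
    simp

/-- For `A` Hurwitz stable, cross-positive over the proper cone `K`, and `K`-irreducible
(no eigenvector of `A` on the boundary of `K`): for every `s₀ ≥ 0` the matrix `s₀ I − A`
is invertible, `(s₀ I − A)⁻¹` is `K`-positive, and `⟨c, (s₀ I − A)⁻¹ b⟩ > 0` for all
nonzero `b ∈ K` and nonzero `c ∈ K*`. -/
theorem stmt8 {n : ℕ} (K : Set (Fin n → ℝ)) (hK : IsProperCone K)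
    (A : Matrix (Fin n) (Fin n) ℝ) (hHur : Hurwitz A) (hCross : CrossPositive K A)
    (hIrr : ¬ ∃ v : Fin n → ℝ, v ≠ 0 ∧ v ∈ frontier K ∧ ∃ μ : ℝ, A.mulVec v = μ • v)
    (s₀ : ℝ) (hs₀ : 0 ≤ s₀) :
    IsUnit (s₀ • (1 : Matrix (Fin n) (Fin n) ℝ) - A) ∧
    (∀ x ∈ K, x ≠ 0 →
      ((s₀ • (1 : Matrix (Fin n) (Fin n) ℝ) - A)⁻¹).mulVec x ∈ interior K) ∧
    (∀ b ∈ K, b ≠ 0 → ∀ c ∈ dualCone K, c ≠ 0 →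
      0 < c ⬝ᵥ ((s₀ • (1 : Matrix (Fin n) (Fin n) ℝ) - A)⁻¹).mulVec b) := by
  exact ⟨(isUnit_iff_isUnit_det _).2 (isUnit_iff_ne_zero.2 (aux_det A hHur s₀ hs₀)),
    fun x hx hx0 => aux_int K hK A hHur hCross hIrr s₀ hs₀ x hx hx0,
    fun b hb hb0 c hc hc0 =>
      aux_pos (aux_int K hK A hHur hCross hIrr s₀ hs₀ b hb hb0) hc hc0⟩
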